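/- A geodesic metric space X is δ-hyperbolic for some δ ≥ 0 (four-point condition) if and only if there exist a point e ∈ X and a constant C ≥ 0 such that for every x ∈ X, every (3,0)-quasi-geodesic with endpoints e and x is contained in the closed C-neighbourhood of some geodesic from e to x. -/

import Mathlib

open Set Filter

section Defs

variable {X : Type*} [MetricSpace X]

/-- A geodesic segment of length `L`, parametrized by arc length on `[0, L]`. -/
def IsGeodesicSeg (γ : ℝ → X) (L : ℝ) : Prop :=
  0 ≤ L ∧ ∀ s ∈ Icc (0:ℝ) L, ∀ t ∈ Icc (0:ℝ) L, dist (γ s) (γ t) = |s - t|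

/-- A geodesic from `x` to `y`, parametrized by arc length on `[0, dist x y]`. -/
def IsGeodesicFromTo (γ : ℝ → X) (x y : X) : Prop :=
  IsGeodesicSeg γ (dist x y) ∧ γ 0 = x ∧ γ (dist x y) = y

/-- A geodesic ray, parametrized by arc length on `[0, ∞)`. -/
def IsGeodesicRay (ℓ : ℝ → X) : Prop :=
  ∀ s ∈ Ici (0:ℝ), ∀ t ∈ Ici (0:ℝ), dist (ℓ s) (ℓ t) = |s - t|

/-- A geodesic metric space: any two points are joined by a geodesic. -/
def GeodesicSpace (X : Type*) [MetricSpace X] : Prop :=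
  ∀ x y : X, ∃ γ : ℝ → X, IsGeodesicFromTo γ x y

/-- A `(K, C)`-quasi-geodesic defined on the interval `I ⊆ ℝ`. -/
def IsQuasiGeodesicOn (K C : ℝ) (I : Set ℝ) (σ : ℝ → X) : Prop :=
  ∀ s ∈ I, ∀ t ∈ I,
    |s - t| / K - C ≤ dist (σ s) (σ t) ∧ dist (σ s) (σ t) ≤ K * |s - t| + C

/-- A Morse gauge: a nonnegative real `N K C` for every `K ≥ 1`, `C ≥ 0`. -/
def IsMorseGauge (N : ℝ → ℝ → ℝ) : Prop :=
  ∀ K C : ℝ, 1 ≤ K → 0 ≤ C → 0 ≤ N K C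

/-- A subset `G ⊆ X` is `N`-Morse if for all `K ≥ 1`, `C ≥ 0`, every
`(K,C)`-quasi-geodesic with endpoints on `G` is contained in the closed
`N K C`-neighbourhood of `G`. -/
def IsMorseSet (N : ℝ → ℝ → ℝ) (G : Set X) : Prop :=
  ∀ K C : ℝ, 1 ≤ K → 0 ≤ C → ∀ a b : ℝ, a ≤ b → ∀ σ : ℝ → X,
    IsQuasiGeodesicOn K C (Icc a b) σ → σ a ∈ G → σ b ∈ G →
    ∀ s ∈ Icc a b, ∃ g ∈ G, dist (σ s) g ≤ N K C

/-- An `N`-Morse geodesic from `x` to `y`. -/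
def IsMorseGeodesicFromTo (N : ℝ → ℝ → ℝ) (γ : ℝ → X) (x y : X) : Prop :=
  IsGeodesicFromTo γ x y ∧ IsMorseSet N (γ '' Icc 0 (dist x y))

/-- An `N`-Morse geodesic ray. -/
def IsMorseRay (N : ℝ → ℝ → ℝ) (ℓ : ℝ → X) : Prop :=
  IsGeodesicRay ℓ ∧ IsMorseSet N (ℓ '' Ici 0)

/-- The stratum `X^(N)_e`: points joined to `e` by an `N`-Morse geodesic. -/
def morseStratum (N : ℝ → ℝ → ℝ) (e : X) : Set X :=
  {y | ∃ γ : ℝ → X, IsMorseGeodesicFromTo N γ e y}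

/-- The Gromov product `(x·y)_w`. -/
noncomputable def gprod (w x y : X) : ℝ := (dist w x + dist w y - dist x y) / 2

/-- A `B`-quasi-convex subset: geodesics with endpoints in `Y` stay in the
closed `B`-neighbourhood of `Y`. -/
def IsQuasiConvex (B : ℝ) (Y : Set X) : Prop :=
  ∀ x ∈ Y, ∀ y ∈ Y, ∀ γ : ℝ → X, IsGeodesicFromTo γ x y →
    ∀ s ∈ Icc (0:ℝ) (dist x y), ∃ g ∈ Y, dist (γ s) g ≤ B

/-- An `N`-stable subset: quasi-convex, and any two of its points are joined
by an `N`-Morse geodesic of `X`. -/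
def IsStableSubset (N : ℝ → ℝ → ℝ) (Y : Set X) : Prop :=
  (∃ B : ℝ, 0 ≤ B ∧ IsQuasiConvex B Y) ∧
    ∀ x ∈ Y, ∀ y ∈ Y, ∃ γ : ℝ → X, IsMorseGeodesicFromTo N γ x y

variable {Y : Type*} [MetricSpace Y]

/-- A `(K,C)`-quasi-isometric embedding. -/
def IsQIEmbedding (K C : ℝ) (q : X → Y) : Prop :=
  ∀ x x' : X,
    dist x x' / K - C ≤ dist (q x) (q x') ∧ dist (q x) (q x') ≤ K * dist x x' + C

/-- A `(K,C)`-quasi-isometry. -/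
def IsQuasiIsometry (K C : ℝ) (q : X → Y) : Prop :=
  IsQIEmbedding K C q ∧ ∀ y : Y, ∃ x : X, dist y (q x) ≤ C

end Defs

section Boundary

variable {X : Type*} [MetricSpace X]

/-- A sequence converges at infinity with respect to the basepoint `e`. -/
def ConvAtInf (e : X) (f : ℕ → X) : Prop :=
  Tendsto (fun p : ℕ × ℕ => gprod e (f p.1) (f p.2)) atTop atTop

/-- Two sequences converging at infinity are equivalent. -/
def EquivAtInf (e : X) (f g : ℕ → X) : Prop :=
  Tendsto (fun p : ℕ × ℕ => gprod e (f p.1) (g p.2)) atTop atTop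

/-- Sequences in `S` converging at infinity. -/
abbrev BSeq (S : Set X) (e : X) : Type _ :=
  {f : ℕ → X // (∀ n, f n ∈ S) ∧ ConvAtInf e f}

/-- The sequential boundary of `S ⊆ X` with basepoint `e`: sequences in `S`
converging at infinity, up to equivalence. -/
def SeqBoundary (S : Set X) (e : X) : Type _ :=
  Quot (fun f g : BSeq S e => EquivAtInf e f.1 g.1)

/-- The boundary point represented by a convergent sequence. -/
def SeqBoundary.mk {S : Set X} {e : X} (f : BSeq S e) : SeqBoundary S e :=
  Quot.mk _ f

/-- The liminf of Gromov products of two sequences, valued in `EReal`. -/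
noncomputable def seqGP (e : X) (f g : ℕ → X) : EReal :=
  Filter.liminf (fun p : ℕ × ℕ => ((gprod e (f p.1) (g p.2) : ℝ) : EReal)) atTop

/-- The Gromov product of two boundary points: the supremum over representing
sequences of the liminf of Gromov products. -/
noncomputable def bGP (S : Set X) (e : X) (ξ η : SeqBoundary S e) : EReal :=
  sSup {r : EReal | ∃ f g : BSeq S e,
    SeqBoundary.mk f = ξ ∧ SeqBoundary.mk g = η ∧ r = seqGP e f.1 g.1}

open Classical in
/-- `exp (−ε·r)` for an extended real `r`, with value `0` at `r = ⊤`. -/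
noncomputable def visGauge (ε : ℝ) (r : EReal) : ℝ :=
  if r = ⊤ then 0 else Real.exp (-ε * r.toReal)

/-- `d` is a visual metric on the sequential boundary of `S`:
a metric comparable to `exp(−ε·(Gromov product))` for some parameter `ε > 0`. -/
def IsVisualMetric (S : Set X) (e : X)
    (d : SeqBoundary S e → SeqBoundary S e → ℝ) : Prop :=
  (∀ ξ η, 0 ≤ d ξ η) ∧ (∀ ξ η, d ξ η = d η ξ) ∧
  (∀ ξ η ζ, d ξ ζ ≤ d ξ η + d η ζ) ∧ (∀ ξ η, d ξ η = 0 ↔ ξ = η) ∧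
  ∃ ε : ℝ, 0 < ε ∧ ∃ k₁ : ℝ, 0 < k₁ ∧ ∃ k₂ : ℝ, 0 < k₂ ∧
    ∀ ξ η, k₁ * visGauge ε (bGP S e ξ η) ≤ d ξ η ∧
      d ξ η ≤ k₂ * visGauge ε (bGP S e ξ η)

/-- `η` is (the restriction of) a self-homeomorphism of `[0,∞)`. -/
def IsHomeoIci (η : ℝ → ℝ) : Prop :=
  ContinuousOn η (Ici 0) ∧ StrictMonoOn η (Ici 0) ∧ η 0 = 0 ∧
    Tendsto η atTop atTop ∧ ∀ t ∈ Ici (0:ℝ), 0 ≤ η t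

/-- `F` is a quasi-symmetry onto its image, for the "distances" `dA`, `dB`. -/
def IsQuasiSymmetryOnto {A B : Type*} (dA : A → A → ℝ) (dB : B → B → ℝ)
    (F : A → B) : Prop :=
  Function.Injective F ∧ ∃ η : ℝ → ℝ, IsHomeoIci η ∧
    ∀ x y z : A, x ≠ y → x ≠ z → y ≠ z →
      dB (F x) (F y) / dB (F x) (F z) ≤ η (dA x y / dA x z)

end Boundary

/-- `X` (with basepoint `x`) is stably subsumed by `Y` (with basepoint `y`):
every stratum of `X` quasi-isometrically embeds in some stratum of `Y`. -/
def StablySubsumed (X Y : Type*) [MetricSpace X] [MetricSpace Y]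
    (x : X) (y : Y) : Prop :=
  ∀ N : ℝ → ℝ → ℝ, IsMorseGauge N →
    ∃ N' : ℝ → ℝ → ℝ, IsMorseGauge N' ∧
      ∃ K C : ℝ, 1 ≤ K ∧ 0 ≤ C ∧ ∃ f : X → Y,
        (∀ a ∈ morseStratum N x, f a ∈ morseStratum N' y) ∧
        ∀ a ∈ morseStratum N x, ∀ b ∈ morseStratum N x,
          dist a b / K - C ≤ dist (f a) (f b) ∧ dist (f a) (f b) ≤ K * dist a b + C

/-- Durham–Taylor stability of `f : Y → X`. -/
def DTStable {Y X : Type*} [MetricSpace Y] [MetricSpace X] (f : Y → X) : Prop :=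
  ∀ K C : ℝ, 1 ≤ K → 0 ≤ C → ∃ R : ℝ, 0 ≤ R ∧
    ∀ a₁ b₁ a₂ b₂ : ℝ, a₁ ≤ b₁ → a₂ ≤ b₂ → ∀ σ₁ σ₂ : ℝ → X,
      IsQuasiGeodesicOn K C (Icc a₁ b₁) σ₁ → IsQuasiGeodesicOn K C (Icc a₂ b₂) σ₂ →
      σ₁ a₁ = σ₂ a₂ → σ₁ b₁ = σ₂ b₂ →
      σ₁ a₁ ∈ Set.range f → σ₁ b₁ ∈ Set.range f →
      (∀ s ∈ Icc a₁ b₁, ∃ t ∈ Icc a₂ b₂, dist (σ₁ s) (σ₂ t) ≤ R) ∧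
      (∀ t ∈ Icc a₂ b₂, ∃ s ∈ Icc a₁ b₁, dist (σ₁ s) (σ₂ t) ≤ R)

section Proofs

variable {X : Type*} [MetricSpace X]

/-- A Lipschitz-type bound gives continuity on a set. -/
lemma contOn_of_lip {σ : ℝ → X} {K : ℝ} {I : Set ℝ} (hK : 0 ≤ K)
    (h : ∀ s ∈ I, ∀ t ∈ I, dist (σ s) (σ t) ≤ K * |s - t|) : ContinuousOn σ I := by
  have : LipschitzOnWith ⟨K, hK⟩ σ I := by
    apply LipschitzOnWith.of_dist_le_mul
    intro s hs t ht
    have := h s hs t ht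
    rw [Real.dist_eq]; exact this
  exact this.continuousOn

lemma seg_contOn {γ : ℝ → X} {L : ℝ} (h : IsGeodesicSeg γ L) : ContinuousOn γ (Icc 0 L) :=
  contOn_of_lip (K := 1) (by norm_num) (fun s hs t ht => by rw [h.2 s hs t ht]; linarith)

lemma qg_contOn {σ : ℝ → X} {a b : ℝ} (h : IsQuasiGeodesicOn 3 0 (Icc a b) σ) :
    ContinuousOn σ (Icc a b) :=
  contOn_of_lip (K := 3) (by norm_num) (fun s hs t ht => by linarith [(h s hs t ht).2])

/-- Distance between ordered points of a segment. -/
lemma seg_dist {γ : ℝ → X} {L s t : ℝ} (h : IsGeodesicSeg γ L) (hs : 0 ≤ s) (hst : s ≤ t)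
    (ht : t ≤ L) : dist (γ s) (γ t) = t - s := by
  rw [h.2 s ⟨hs, hst.trans ht⟩ t ⟨hs.trans hst, ht⟩, abs_sub_comm, abs_of_nonneg (by linarith)]

lemma infDist_attained {γ : ℝ → X} {a b : ℝ} (hab : a ≤ b) (h : ContinuousOn γ (Icc a b))
    (z : X) : ∃ u ∈ Icc a b, Metric.infDist z (γ '' Icc a b) = dist z (γ u) := by
  have hc : IsCompact (γ '' Icc a b) := isCompact_Icc.image_of_continuousOn h
  have hne : (γ '' Icc a b).Nonempty := (nonempty_Icc.2 hab).image γ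
  obtain ⟨_, ⟨u, hu, rfl⟩, h2⟩ := hc.exists_infDist_eq_dist hne z
  exact ⟨u, hu, h2⟩

lemma infDist_le' {γ : ℝ → X} {a b u : ℝ} (hu : u ∈ Icc a b) (z : X) :
    Metric.infDist z (γ '' Icc a b) ≤ dist z (γ u) :=
  Metric.infDist_le_dist_of_mem (mem_image_of_mem γ hu)

/-! ### Hyperbolic implies stability of quasi-geodesics -/

lemma chain_gprod {δ : ℝ}
    (H : ∀ w x y z : X, gprod w x y ≥ min (gprod w x z) (gprod w z y) - δ) (w : X) (R : ℝ)
    (n : ℕ) : ∀ y : ℕ → X, (∀ i < 2 ^ n, R ≤ gprod w (y i) (y (i + 1))) →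
      R - n * δ ≤ gprod w (y 0) (y (2 ^ n)) := by
  induction n with
  | zero => intro y h; simpa using h 0 (by norm_num)
  | succ n ih =>
    intro y h
    have h1 := ih y (fun i hi => h i (by rw [pow_succ]; omega))
    have h2 := ih (fun i => y (i + 2 ^ n)) (fun i hi => by
      have := h (i + 2 ^ n) (by rw [pow_succ]; omega)
      simpa [add_right_comm] using this)
    simp only [zero_add] at h2
    have h3 := H w (y 0) (y (2 ^ (n + 1))) (y (2 ^ n))
    have e : 2 ^ n + 2 ^ n = 2 ^ (n + 1) := by rw [pow_succ]; omega
    rw [e] at h2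
    have := le_min h1 h2
    push_cast
    linarith

lemma log_bound (δ : ℝ) (hδ : 0 ≤ δ) : ∃ D0 : ℝ, 0 ≤ D0 ∧ ∀ D : ℝ, 0 ≤ D →
    (∀ n : ℕ, 54 * D ≤ 2 ^ n → D ≤ 1 / 2 + (n + 2) * δ) → D ≤ D0 := by
  have ht : Tendsto (fun n : ℕ => (n : ℝ) / 2 ^ n) atTop (nhds 0) := by
    simpa using tendsto_pow_const_div_const_pow_of_one_lt 1 (r := (2 : ℝ)) (by norm_num)
  have ht2 : Tendsto (fun n : ℕ => (1 : ℝ) / 2 ^ n) atTop (nhds 0) := by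
    simpa using tendsto_pow_const_div_const_pow_of_one_lt 0 (r := (2 : ℝ)) (by norm_num)
  have ht3 : Tendsto (fun n : ℕ => 108 * δ * ((n : ℝ) / 2 ^ n) +
      108 * (1 / 2 + 2 * δ) * ((1 : ℝ) / 2 ^ n)) atTop (nhds 0) := by
    simpa using (ht.const_mul (108 * δ)).add (ht2.const_mul (108 * (1 / 2 + 2 * δ)))
  obtain ⟨n0, hn0⟩ := eventually_atTop.1 (ht3.eventually (gt_mem_nhds (zero_lt_one)))
  refine ⟨1 / 2 + (n0 + 2) * δ, by positivity, fun D hD h => ?_⟩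
  have hex : ∃ n : ℕ, 54 * D ≤ 2 ^ n := by
    obtain ⟨n, hn⟩ := pow_unbounded_of_one_lt (54 * D) (one_lt_two : (1 : ℝ) < 2)
    exact ⟨n, hn.le⟩
  classical
  obtain ⟨n, hn, hmin⟩ : ∃ n : ℕ, 54 * D ≤ 2 ^ n ∧ ∀ m < n, ¬ (54 * D ≤ (2 : ℝ) ^ m) :=
    ⟨Nat.find hex, Nat.find_spec hex, fun m hm => Nat.find_min hex hm⟩
  have hDn := h n hn
  by_cases hlt : n ≤ n0
  · have : (n : ℝ) ≤ n0 := by exact_mod_cast hlt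
    nlinarith
  · exfalso
    push Not at hlt
    obtain ⟨m, rfl⟩ : ∃ m, n = m + 1 := ⟨n - 1, by omega⟩
    have h1 := hmin m (by omega)
    push Not at h1
    have h2 := hn0 (m + 1) (by omega)
    have hp : (0 : ℝ) < 2 ^ (m + 1) := by positivity
    have h3 : 108 * δ * (((m + 1 : ℕ) : ℝ)) + 108 * (1 / 2 + 2 * δ) < 2 ^ (m + 1) := by
      have e : 108 * δ * ((((m + 1 : ℕ) : ℝ)) / 2 ^ (m + 1)) +
        108 * (1 / 2 + 2 * δ) * ((1 : ℝ) / 2 ^ (m + 1)) =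
        (108 * δ * (((m + 1 : ℕ) : ℝ)) + 108 * (1 / 2 + 2 * δ)) / 2 ^ (m + 1) := by ring
      rw [e, div_lt_one hp] at h2
      exact h2
    rw [pow_succ] at h3
    push_cast at h3 hDn
    nlinarith

lemma geod_near_qg {δ : ℝ} (hδ : 0 ≤ δ)
    (H : ∀ w x y z : X, gprod w x y ≥ min (gprod w x z) (gprod w z y) - δ) :
    ∃ D0 : ℝ, 0 ≤ D0 ∧ ∀ (e x : X) (a b : ℝ) (σ γ : ℝ → X), a ≤ b →
      IsQuasiGeodesicOn 3 0 (Icc a b) σ → σ a = e → σ b = x → IsGeodesicFromTo γ e x →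
      ∀ t ∈ Icc 0 (dist e x), ∃ s ∈ Icc a b, dist (γ t) (σ s) ≤ D0 := by
  obtain ⟨D0, hD0, hlog⟩ := log_bound δ hδ
  refine ⟨D0, hD0, ?_⟩
  intro e x a b σ γ hab hq hsa hsb hγ
  obtain ⟨hseg, hg0, hg1⟩ := hγ
  set L := dist e x with hL
  have hL0 : 0 ≤ L := dist_nonneg
  have hcs := qg_contOn hq
  have hcg := seg_contOn hseg
  have hF : ContinuousOn (fun t => Metric.infDist (γ t) (σ '' Icc a b)) (Icc 0 L) :=
    (Metric.continuous_infDist_pt _).comp_continuousOn hcg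
  obtain ⟨t0, ht0, hmax⟩ := isCompact_Icc.exists_isMaxOn (nonempty_Icc.2 hL0) hF
  set D := Metric.infDist (γ t0) (σ '' Icc a b) with hD
  have hDn : 0 ≤ D := Metric.infDist_nonneg
  have hmax' : ∀ t ∈ Icc 0 L, Metric.infDist (γ t) (σ '' Icc a b) ≤ D := fun t ht => hmax ht
  have hw : ∀ s ∈ Icc a b, D ≤ dist (γ t0) (σ s) := fun s hs => infDist_le' hs _
  suffices hDD : D ≤ D0 by
    intro t ht
    obtain ⟨s, hs, h⟩ := infDist_attained hab hcs (γ t)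
    exact ⟨s, hs, by rw [← h]; exact (hmax' t ht).trans hDD⟩
  have left : ∃ t1 s, 0 ≤ t1 ∧ t1 ≤ t0 ∧ t0 - t1 ≤ 2 * D ∧ s ∈ Icc a b ∧
      dist (γ t1) (σ s) ≤ D ∧ D ≤ gprod (γ t0) (γ t1) (σ s) := by
    by_cases hc : 0 ≤ t0 - 2 * D
    · have hm : t0 - 2 * D ∈ Icc 0 L := ⟨hc, by linarith [ht0.2]⟩
      obtain ⟨s, hs, h⟩ := infDist_attained hab hcs (γ (t0 - 2 * D))
      have h1 : dist (γ (t0 - 2 * D)) (σ s) ≤ D := by rw [← h]; exact hmax' _ hm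
      refine ⟨t0 - 2 * D, s, hc, by linarith, by linarith, hs, h1, ?_⟩
      have h2 := seg_dist hseg hc (by linarith) ht0.2
      rw [dist_comm] at h2
      have h3 := hw s hs
      unfold gprod; linarith
    · refine ⟨0, a, le_rfl, ht0.1, by linarith, ⟨le_rfl, hab⟩, ?_, ?_⟩
      · rw [hg0, hsa, dist_self]; exact hDn
      · have h3 := hw a ⟨le_rfl, hab⟩
        unfold gprod
        rw [hg0, hsa, dist_self]
        rw [hsa] at h3
        linarith
  have right : ∃ t2 s, t0 ≤ t2 ∧ t2 ≤ L ∧ t2 - t0 ≤ 2 * D ∧ s ∈ Icc a b ∧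
      dist (γ t2) (σ s) ≤ D ∧ D ≤ gprod (γ t0) (σ s) (γ t2) := by
    by_cases hc : t0 + 2 * D ≤ L
    · have hm : t0 + 2 * D ∈ Icc 0 L := ⟨by linarith [ht0.1], hc⟩
      obtain ⟨s, hs, h⟩ := infDist_attained hab hcs (γ (t0 + 2 * D))
      have h1 : dist (γ (t0 + 2 * D)) (σ s) ≤ D := by rw [← h]; exact hmax' _ hm
      refine ⟨t0 + 2 * D, s, by linarith, hc, by linarith, hs, h1, ?_⟩
      have h2 := seg_dist hseg ht0.1 (by linarith) hc
      have h3 := hw s hs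
      rw [dist_comm] at h1
      unfold gprod; linarith
    · refine ⟨L, b, ht0.2, le_rfl, by linarith, ⟨hab, le_rfl⟩, ?_, ?_⟩
      · rw [hg1, hsb, dist_self]; exact hDn
      · have h3 := hw b ⟨hab, le_rfl⟩
        unfold gprod
        rw [hg1, hsb, dist_self]
        rw [hsb] at h3
        linarith
  obtain ⟨t1, s1, ht1, ht1', ht1D, hs1, hd1, hp1⟩ := left
  obtain ⟨t2, s2, ht2, ht2', ht2D, hs2, hd2, hp2⟩ := right
  apply hlog D hDn
  intro n hn
  have hdist : dist (σ s1) (σ s2) ≤ 6 * D := by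
    have h1 := dist_triangle4 (σ s1) (γ t1) (γ t2) (σ s2)
    rw [seg_dist hseg ht1 (ht1'.trans ht2) ht2', dist_comm (σ s1) (γ t1)] at h1
    linarith
  have hs12 : |s1 - s2| ≤ 18 * D := by
    have := (hq s1 hs1 s2 hs2).1
    linarith
  have hpos : (0 : ℝ) < 2 ^ n := by positivity
  let y : ℕ → X := fun i => σ (s1 + (i : ℝ) / 2 ^ n * (s2 - s1))
  have hmem : ∀ i : ℕ, i ≤ 2 ^ n → s1 + (i : ℝ) / 2 ^ n * (s2 - s1) ∈ Icc a b := by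
    intro i hi
    have h0 : 0 ≤ (i : ℝ) / 2 ^ n := by positivity
    have h1 : (i : ℝ) / 2 ^ n ≤ 1 := by
      rw [div_le_one hpos]; exact_mod_cast hi
    have h2 := hs1.1; have h3 := hs1.2; have h4 := hs2.1; have h5 := hs2.2
    constructor <;> nlinarith
  have hch := chain_gprod H (γ t0) (D - 1 / 2) n y (by
    intro i hi
    have m1 := hmem i hi.le
    have m2 := hmem (i + 1) hi
    have hd := (hq _ m1 _ m2).2
    have e : (s1 + (i : ℝ) / 2 ^ n * (s2 - s1)) - (s1 + ((i + 1 : ℕ) : ℝ) / 2 ^ n * (s2 - s1))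
      = (s1 - s2) / 2 ^ n := by push_cast; field_simp; ring
    rw [e, abs_div, abs_of_pos hpos] at hd
    have h3 : |s1 - s2| / 2 ^ n ≤ 1 / 3 := by
      rw [div_le_iff₀ hpos]; linarith
    have h4 := hw _ m1
    have h5 := hw _ m2
    simp only [gprod, y]
    linarith)
  have e0 : y 0 = σ s1 := by simp [y]
  have e1 : y (2 ^ n) = σ s2 := by
    simp only [y]; push_cast; rw [div_self hpos.ne']; congr 1; ring
  rw [e0, e1] at hch
  have h0 : gprod (γ t0) (γ t1) (γ t2) = 0 := by
    unfold gprod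
    rw [dist_comm (γ t0), seg_dist hseg ht1 ht1' ht0.2, seg_dist hseg ht0.1 ht2 ht2',
      seg_dist hseg ht1 (ht1'.trans ht2) ht2']
    ring
  have k1 := H (γ t0) (γ t1) (γ t2) (σ s1)
  have k2 := H (γ t0) (σ s1) (γ t2) (σ s2)
  have hnn : 0 ≤ (n : ℝ) * δ := by positivity
  have k3 : D - 1 / 2 - n * δ ≤ min (gprod (γ t0) (σ s1) (σ s2)) (gprod (γ t0) (σ s2) (γ t2)) :=
    le_min hch (by linarith)
  have k4 : D - 1 / 2 - n * δ - δ ≤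
      min (gprod (γ t0) (γ t1) (σ s1)) (gprod (γ t0) (σ s1) (γ t2)) :=
    le_min (by linarith) (by linarith)
  linarith

lemma qg_near_geod {δ : ℝ} (hδ : 0 ≤ δ)
    (H : ∀ w x y z : X, gprod w x y ≥ min (gprod w x z) (gprod w z y) - δ) :
    ∃ C : ℝ, 0 ≤ C ∧ ∀ (e x : X) (a b : ℝ) (σ γ : ℝ → X), a ≤ b →
      IsQuasiGeodesicOn 3 0 (Icc a b) σ → σ a = e → σ b = x → IsGeodesicFromTo γ e x →
      ∀ s ∈ Icc a b, ∃ t ∈ Icc 0 (dist e x), dist (σ s) (γ t) ≤ C := by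
  obtain ⟨D0, hD0, hD⟩ := geod_near_qg hδ H
  refine ⟨19 * D0, by positivity, ?_⟩
  intro e x a b σ γ hab hq hsa hsb hγ s hs
  have hnear := hD e x a b σ γ hab hq hsa hsb hγ
  obtain ⟨hseg, hg0, hg1⟩ := hγ
  set L := dist e x with hL
  have hL0 : 0 ≤ L := dist_nonneg
  have hcs := qg_contOn hq
  have hcg := seg_contOn hseg
  have c1 : ContinuousOn σ (Icc a s) := hcs.mono (Icc_subset_Icc le_rfl hs.2)
  have c2 : ContinuousOn σ (Icc s b) := hcs.mono (Icc_subset_Icc hs.1 le_rfl)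
  have hA : ContinuousOn (fun t => Metric.infDist (γ t) (σ '' Icc a s) -
      Metric.infDist (γ t) (σ '' Icc s b)) (Icc 0 L) :=
    ((Metric.continuous_infDist_pt _).comp_continuousOn hcg).sub
      ((Metric.continuous_infDist_pt _).comp_continuousOn hcg)
  have hiv := intermediate_value_Icc hL0 hA
  have hz : (0 : ℝ) ∈ Icc (Metric.infDist (γ 0) (σ '' Icc a s) -
      Metric.infDist (γ 0) (σ '' Icc s b)) (Metric.infDist (γ L) (σ '' Icc a s) -
      Metric.infDist (γ L) (σ '' Icc s b)) := by
    have h1 : Metric.infDist (γ 0) (σ '' Icc a s) ≤ 0 := by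
      have := infDist_le' (γ := σ) (a := a) (b := s) (u := a) ⟨le_rfl, hs.1⟩ (γ 0)
      rwa [hg0, hsa, dist_self, ← hg0] at this
    have h2 : Metric.infDist (γ L) (σ '' Icc s b) ≤ 0 := by
      have := infDist_le' (γ := σ) (a := s) (b := b) (u := b) ⟨hs.2, le_rfl⟩ (γ L)
      rwa [hg1, hsb, dist_self, ← hg1] at this
    have h3 : 0 ≤ Metric.infDist (γ 0) (σ '' Icc s b) := Metric.infDist_nonneg
    have h4 : 0 ≤ Metric.infDist (γ L) (σ '' Icc a s) := Metric.infDist_nonneg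
    constructor <;> linarith
  obtain ⟨t, ht, heq⟩ := hiv hz
  simp only at heq
  obtain ⟨s1, hs1, h1⟩ := infDist_attained hs.1 c1 (γ t)
  obtain ⟨s2, hs2, h2⟩ := infDist_attained hs.2 c2 (γ t)
  obtain ⟨s3, hs3, h3⟩ := hnear t ht
  have hb : dist (γ t) (σ s1) ≤ D0 ∧ dist (γ t) (σ s2) ≤ D0 := by
    rcases le_total s3 s with h | h
    · have := infDist_le' (γ := σ) (a := a) (b := s) (u := s3) ⟨hs3.1, h⟩ (γ t)
      constructor <;> linarith
    · have := infDist_le' (γ := σ) (a := s) (b := b) (u := s3) ⟨h, hs3.2⟩ (γ t)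
      constructor <;> linarith
  refine ⟨t, ht, ?_⟩
  have m1 : s1 ∈ Icc a b := ⟨hs1.1, hs1.2.trans hs.2⟩
  have m2 : s2 ∈ Icc a b := ⟨hs.1.trans hs2.1, hs2.2⟩
  have q1 := (hq s1 m1 s2 m2).1
  have q2 := (hq s hs s1 m1).2
  have h12 := dist_triangle_left (σ s1) (σ s2) (γ t)
  rw [abs_sub_comm, abs_of_nonneg (by linarith [hs1.2, hs2.1])] at q1
  rw [abs_of_nonneg (by linarith [hs1.2])] at q2
  have h4 := dist_triangle_right (σ s) (γ t) (σ s1)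
  linarith [hb.1, hb.2, hs2.1]

/-! ### Stability from one basepoint implies hyperbolicity -/

/-- The stability condition at the basepoint `e` with constant `C`. -/
def StabAt (e : X) (C : ℝ) : Prop :=
  ∀ x : X, ∀ a b : ℝ, a ≤ b → ∀ σ : ℝ → X,
    IsQuasiGeodesicOn 3 0 (Icc a b) σ → σ a = e → σ b = x →
    ∃ γ : ℝ → X, IsGeodesicFromTo γ e x ∧
      ∀ s ∈ Icc a b, ∃ t ∈ Icc (0:ℝ) (dist e x), dist (σ s) (γ t) ≤ C

lemma qg_of_le {σ : ℝ → X} {I : Set ℝ}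
    (h : ∀ s ∈ I, ∀ t ∈ I, s ≤ t →
      (t - s) / 3 ≤ dist (σ s) (σ t) ∧ dist (σ s) (σ t) ≤ 3 * (t - s)) :
    IsQuasiGeodesicOn 3 0 I σ := by
  intro s hs t ht
  rcases le_total s t with hst | hst
  · rw [abs_sub_comm, abs_of_nonneg (by linarith)]
    have := h s hs t ht hst
    constructor <;> linarith [this.1, this.2]
  · rw [abs_of_nonneg (by linarith), dist_comm]
    have := h t ht s hs hst
    constructor <;> linarith [this.1, this.2]

lemma qg_le {σ : ℝ → X} {I : Set ℝ} (h : IsQuasiGeodesicOn 3 0 I σ) {s t : ℝ} (hs : s ∈ I)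
    (ht : t ∈ I) (hst : s ≤ t) :
    (t - s) / 3 ≤ dist (σ s) (σ t) ∧ dist (σ s) (σ t) ≤ 3 * (t - s) := by
  have := h s hs t ht
  rw [abs_sub_comm, abs_of_nonneg (by linarith)] at this
  constructor <;> linarith [this.1, this.2]

lemma qg_concat {σ₁ σ₂ : ℝ → X} {a b c : ℝ} (hab : a ≤ b) (hbc : b ≤ c)
    (h1 : IsQuasiGeodesicOn 3 0 (Icc a b) σ₁) (h2 : IsQuasiGeodesicOn 3 0 (Icc b c) σ₂)
    (hj : σ₁ b = σ₂ b)
    (hx : ∀ s ∈ Icc a b, ∀ t ∈ Icc b c, (t - s) / 3 ≤ dist (σ₁ s) (σ₂ t)) :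
    IsQuasiGeodesicOn 3 0 (Icc a c) (fun t => if t ≤ b then σ₁ t else σ₂ t) := by
  apply qg_of_le
  intro s hs t ht hst
  by_cases htb : t ≤ b
  · have hsb : s ≤ b := hst.trans htb
    simp only [htb, hsb, if_true]
    exact qg_le h1 ⟨hs.1, hsb⟩ ⟨ht.1, htb⟩ hst
  · by_cases hsb : s ≤ b
    · simp only [htb, hsb, if_true, if_false]
      push Not at htb
      refine ⟨hx s ⟨hs.1, hsb⟩ t ⟨htb.le, ht.2⟩, ?_⟩
      have k1 := (qg_le h1 (s := s) (t := b) ⟨hs.1, hsb⟩ ⟨hab, le_rfl⟩ hsb).2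
      have k2 := (qg_le h2 (s := b) (t := t) ⟨le_rfl, hbc⟩ ⟨htb.le, ht.2⟩ htb.le).2
      have k3 := dist_triangle (σ₁ s) (σ₁ b) (σ₂ t)
      rw [hj] at k1 k3
      linarith
    · simp only [htb, hsb, if_false]
      push Not at htb hsb
      exact qg_le h2 ⟨hsb.le, hs.2⟩ ⟨htb.le, ht.2⟩ hst

lemma qg_seg {γ : ℝ → X} {L b c u : ℝ} (h : IsGeodesicSeg γ L) (hu : 0 ≤ u)
    (huc : u + (c - b) ≤ L) :
    IsQuasiGeodesicOn 3 0 (Icc b c) (fun t => γ (t - b + u)) := by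
  apply qg_of_le
  intro s hs t ht hst
  have := seg_dist h (s := s - b + u) (t := t - b + u) (by linarith [hs.1]) (by linarith)
    (by linarith [ht.2])
  simp only [this]
  constructor <;> linarith

lemma stab_through {e : X} {C : ℝ} (H : StabAt e C) {σ : ℝ → X} {a b s : ℝ}
    (hq : IsQuasiGeodesicOn 3 0 (Icc a b) σ) (ha : σ a = e) (hs : s ∈ Icc a b) :
    dist e (σ s) + dist (σ s) (σ b) ≤ dist e (σ b) + 2 * C := by
  obtain ⟨γ, ⟨hseg, h0, h1⟩, h⟩ := H (σ b) a b (hs.1.trans hs.2) σ hq ha rfl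
  obtain ⟨t, ht, hd⟩ := h s hs
  have k1 := seg_dist hseg le_rfl ht.1 ht.2
  have k2 := seg_dist hseg ht.1 ht.2 le_rfl
  rw [h0] at k1
  rw [h1] at k2
  have k3 := dist_triangle_right e (σ s) (γ t)
  have k4 := dist_triangle (σ s) (γ t) (σ b)
  linarith

/-- Going along `β` and then to `z` from a nearest point is a quasi-geodesic. -/
lemma qg_proj {β ζ : ℝ → X} {Lb v : ℝ} {z : X} (hβ : IsGeodesicSeg β Lb)
    (hv : v ∈ Icc 0 Lb) (hnear : ∀ t ∈ Icc 0 Lb, dist (β v) z ≤ dist (β t) z)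
    (hζ : IsGeodesicFromTo ζ (β v) z) :
    IsQuasiGeodesicOn 3 0 (Icc 0 (v + dist (β v) z))
      (fun t => if t ≤ v then β t else ζ (t - v)) := by
  obtain ⟨hseg, h0, h1⟩ := hζ
  have q1 : IsQuasiGeodesicOn 3 0 (Icc 0 v) β := by
    simpa using qg_seg (b := 0) (c := v) (u := 0) hβ le_rfl (by linarith [hv.2])
  have q2 : IsQuasiGeodesicOn 3 0 (Icc v (v + dist (β v) z)) (fun t => ζ (t - v)) := by
    simpa using qg_seg (b := v) (c := v + dist (β v) z) (u := 0) hseg le_rfl (by linarith)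
  refine qg_concat hv.1 (by linarith [dist_nonneg (x := β v) (y := z)]) q1 q2
    (by simp [h0]) ?_
  intro s hs t ht
  have k1 := hnear s ⟨hs.1, hs.2.trans hv.2⟩
  have k2 := seg_dist hseg (s := t - v) (t := dist (β v) z) (by linarith [ht.1])
    (by linarith [ht.2]) le_rfl
  have k3 := seg_dist hseg (s := 0) (t := t - v) le_rfl (by linarith [ht.1])
    (by linarith [ht.2])
  have k4 := seg_dist hβ hs.1 hs.2 hv.2
  rw [h1] at k2
  rw [h0] at k3
  have k5 := dist_triangle (β s) (ζ (t - v)) z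
  have k6 := dist_triangle_right (β s) (β v) (ζ (t - v))
  linarith

lemma stab_proj {e : X} {C : ℝ} (hX : GeodesicSpace X) (H : StabAt e C) {β : ℝ → X}
    {Lb v : ℝ} {z : X} (hβ : IsGeodesicSeg β Lb) (h0 : β 0 = e)
    (hv : v ∈ Icc 0 Lb) (hnear : ∀ t ∈ Icc 0 Lb, dist (β v) z ≤ dist (β t) z) :
    v + dist (β v) z ≤ dist e z + 2 * C := by
  obtain ⟨ζ, hζ⟩ := hX (β v) z
  have hq := qg_proj hβ hv hnear hζ
  have hd : 0 ≤ dist (β v) z := dist_nonneg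
  have hT := stab_through H (s := v) hq (by simp [hv.1, h0]) ⟨hv.1, by linarith⟩
  have e1 : (if v + dist (β v) z ≤ v then β (v + dist (β v) z)
      else ζ (v + dist (β v) z - v)) = z := by
    split_ifs with hc
    · have hz : dist (β v) z = 0 := by linarith
      rw [hz, add_zero]; exact dist_eq_zero.1 hz
    · rw [add_sub_cancel_left]; exact hζ.2.2
  simp only [e1, le_refl, if_true] at hT
  have k := seg_dist hβ le_rfl hv.1 hv.2
  rw [h0] at k
  linarith

/-- The key lemma: the distance from `β v` to `α` cannot stay nondecreasing backwards
on a long window at a point where it is large. -/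
lemma no_descent {e : X} {C : ℝ} (hC : 0 < C) (hX : GeodesicSpace X) (H : StabAt e C)
    {α β : ℝ → X} {La Lb : ℝ} (hα : IsGeodesicSeg α La) (hβ : IsGeodesicSeg β Lb)
    (hα0 : α 0 = e) (hβ0 : β 0 = e) {v : ℝ} (hv : v ∈ Icc 0 Lb)
    (hbig : 11 * C ≤ Metric.infDist (β v) (α '' Icc 0 La))
    (hwin : ∀ t ∈ Icc 0 v, v - 22 * C ≤ t →
      Metric.infDist (β v) (α '' Icc 0 La) ≤ Metric.infDist (β t) (α '' Icc 0 La)) :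
    False := by
  obtain ⟨u, hu, hDu⟩ := infDist_attained hα.1 (seg_contOn hα) (β v)
  set D := Metric.infDist (β v) (α '' Icc 0 La) with hD
  have hnearα : ∀ t ∈ Icc 0 La, dist (α u) (β v) ≤ dist (α t) (β v) := by
    intro t ht
    rw [dist_comm (α u), dist_comm (α t), ← hDu]
    exact infDist_le' ht _
  have hev : dist e (β v) = v := by
    have := seg_dist hβ le_rfl hv.1 hv.2
    rw [hβ0] at this; linarith
  have heu : dist e (α u) = u := by
    have := seg_dist hα le_rfl hu.1 hu.2
    rw [hα0] at this; linarith
  have hP := stab_proj hX H hα hα0 hu hnearα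
  rw [dist_comm (α u), ← hDu, hev] at hP
  obtain ⟨Γ, hΓ, hΓ0, hΓ1⟩ := hX (β v) (α u)
  rw [← hDu] at hΓ hΓ1
  -- norms of points of Γ
  have hz : ∀ s ∈ Icc 0 D, dist (β v) (Γ s) = s := by
    intro s hs
    have := seg_dist hΓ le_rfl hs.1 hs.2
    rw [hΓ0] at this; linarith
  have hw : ∀ s ∈ Icc 0 D, dist (Γ s) (α u) = D - s := by
    intro s hs
    have := seg_dist hΓ hs.1 hs.2 le_rfl
    rwa [hΓ1] at this
  have hn1 : ∀ s ∈ Icc 0 D, v - s ≤ dist e (Γ s) := by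
    intro s hs
    have := dist_triangle_right e (β v) (Γ s)
    linarith [hz s hs]
  have hn2 : ∀ s ∈ Icc 0 D, dist e (Γ s) ≤ v + 2 * C - s := by
    intro s hs
    have := dist_triangle_right e (Γ s) (α u)
    linarith [hw s hs]
  have heβ : ∀ t ∈ Icc 0 Lb, dist e (β t) = t := by
    intro t ht
    have := seg_dist hβ le_rfl ht.1 ht.2
    rw [hβ0] at this; linarith
  -- distance from Γ s to β
  have hlow : ∀ s ∈ Icc 0 (11 * C), ∀ t ∈ Icc 0 Lb, s - C ≤ dist (Γ s) (β t) := by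
    intro s hs t ht
    have hsD : s ∈ Icc 0 D := ⟨hs.1, hs.2.trans hbig⟩
    have hf : Metric.infDist (β t) (α '' Icc 0 La) ≤ dist (Γ s) (β t) + (D - s) := by
      have k1 := infDist_le' (γ := α) hu (β t)
      have k2 := dist_triangle_left (β t) (α u) (Γ s)
      linarith [hw s hsD]
    rcases le_total t v with htv | htv
    · by_cases hc : v - 22 * C ≤ t
      · have := hwin t ⟨ht.1, htv⟩ hc
        linarith
      · have k1 := dist_triangle_right e (Γ s) (β t)
        have k2 := heβ t ht
        have k3 := hn1 s hsD
        linarith [hs.2]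
    · have k1 : D ≤ Metric.infDist (β t) (α '' Icc 0 La) + dist (β v) (β t) :=
        Metric.infDist_le_infDist_add_dist
      rw [seg_dist hβ hv.1 htv ht.2] at k1
      have k2 := dist_triangle e (Γ s) (β t)
      rw [heβ t ht] at k2
      have k3 := hn2 s hsD
      linarith
  have hΓc : ContinuousOn Γ (Icc (6 * C) (11 * C)) :=
    (seg_contOn hΓ).mono (Icc_subset_Icc (by linarith) hbig)
  have hφ : ContinuousOn (fun s => Metric.infDist (Γ s) (β '' Icc 0 Lb) - s / 2)
      (Icc (6 * C) (11 * C)) :=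
    ((Metric.continuous_infDist_pt _).comp_continuousOn hΓc).sub
      (continuous_id.div_const 2).continuousOn
  obtain ⟨r, hr, hmin⟩ := isCompact_Icc.exists_isMinOn
    (nonempty_Icc.2 (by linarith : 6 * C ≤ 11 * C)) hφ
  have hmin' : ∀ s ∈ Icc (6 * C) (11 * C), Metric.infDist (Γ r) (β '' Icc 0 Lb) - r / 2 ≤
    Metric.infDist (Γ s) (β '' Icc 0 Lb) - s / 2 := fun s hs => hmin hs
  obtain ⟨q, hqm, hεq⟩ := infDist_attained hβ.1 (seg_contOn hβ) (Γ r)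
  set ε := Metric.infDist (Γ r) (β '' Icc 0 Lb) with hε
  have hr0 : 0 ≤ r := by linarith [hr.1]
  have hεr : r - C ≤ ε := by rw [hεq]; exact hlow r ⟨hr0, hr.2⟩ q hqm
  have hr8 : r ≤ 8 * C := by
    have k1 := hmin' (6 * C) ⟨le_rfl, by linarith⟩
    have k2 := infDist_le' (γ := β) hv (Γ (6 * C))
    rw [dist_comm, hz (6 * C) ⟨by linarith, by linarith⟩] at k2
    linarith
  have hnearβ : ∀ t ∈ Icc 0 Lb, dist (β q) (Γ r) ≤ dist (β t) (Γ r) := by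
    intro t ht
    rw [dist_comm (β q), dist_comm (β t), ← hεq]
    exact infDist_le' ht _
  have hrD : r ∈ Icc 0 D := ⟨hr0, by linarith⟩
  have hP2 := stab_proj hX H hβ hβ0 hqm hnearβ
  obtain ⟨ζ, hζ⟩ := hX (β q) (Γ r)
  have hqg1 := qg_proj hβ hqm hnearβ hζ
  obtain ⟨hζs, hζ0, hζ1⟩ := hζ
  rw [dist_comm (β q), ← hεq] at hP2 hqg1 hζs hζ1
  have hn2r := hn2 r hrD
  have hqg2 : IsQuasiGeodesicOn 3 0 (Icc (q + ε) (q + ε + 3 * C))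
      (fun t => Γ (t - (q + ε) + r)) :=
    qg_seg hΓ hr0 (by linarith)
  have hε5 : 5 * C ≤ ε := by linarith [hr.1]
  have hup : ∀ b ∈ Icc 0 (3 * C), ∀ t ∈ Icc 0 Lb, ε + b / 2 ≤ dist (Γ (b + r)) (β t) := by
    intro b hb t ht
    have k1 := hmin' (b + r) ⟨by linarith [hb.1, hr.1], by linarith [hb.2]⟩
    have k2 := infDist_le' (γ := β) ht (Γ (b + r))
    linarith
  have hqg := qg_concat (by linarith [hqm.1]) (by linarith) hqg1 hqg2 (by
      have : ¬ (q + ε ≤ q) := by linarith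
      simp [this, hζ1]) (by
    intro s hs t ht
    have hb : t - (q + ε) ∈ Icc 0 (3 * C) := ⟨by linarith [ht.1], by linarith [ht.2]⟩
    by_cases hsq : s ≤ q
    · simp only [hsq, if_true]
      have hsm : s ∈ Icc 0 Lb := ⟨hs.1, hsq.trans hqm.2⟩
      have k1 := hup _ hb s hsm
      have k2 := dist_triangle_right e (Γ (t - (q + ε) + r)) (β s)
      have k3 := hn1 (t - (q + ε) + r) ⟨by linarith [hb.1], by linarith [hb.2]⟩
      rw [heβ s hsm] at k2
      rw [dist_comm (β s)]
      linarith [hb.2]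
    · simp only [hsq, if_false]
      push Not at hsq
      have k1 := hup _ hb q hqm
      have k2 := seg_dist hζs (s := 0) (t := s - q) le_rfl (by linarith) (by linarith [hs.2])
      rw [hζ0, dist_comm] at k2
      have k3 := dist_triangle_left (Γ (t - (q + ε) + r)) (β q) (ζ (s - q))
      linarith [hs.2, hb.1])
  have hT := stab_through H (s := q + ε) hqg (by
    have : 0 ≤ q + ε := by linarith [hqm.1]
    simp [this, hqm.1, hβ0]) ⟨by linarith [hqm.1], by linarith⟩
  have c1 : ¬ (q + ε ≤ q) := by linarith
  have c2 : ¬ (q + ε + 3 * C ≤ q + ε) := by linarith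
  simp only [c1, c2, le_refl, if_true, if_false, add_sub_cancel_left, hζ1] at hT
  have k1 := seg_dist hΓ (s := r) (t := 3 * C + r) hr0 (by linarith) (by linarith)
  have k2 := hn1 r hrD
  have k3 := hn2 (3 * C + r) ⟨by linarith, by linarith⟩
  linarith

lemma dist_control {e : X} {C : ℝ} (hC : 0 < C) (hX : GeodesicSpace X) (H : StabAt e C)
    {α β : ℝ → X} {La Lb : ℝ} (hα : IsGeodesicSeg α La) (hβ : IsGeodesicSeg β Lb)
    (hα0 : α 0 = e) (hβ0 : β 0 = e) {v0 M : ℝ} (hv0 : v0 ∈ Icc 0 Lb) (hM : 11 * C ≤ M)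
    (hf : Metric.infDist (β v0) (α '' Icc 0 La) ≤ M) {v1 : ℝ} (hv1 : v1 ∈ Icc 0 v0) :
    Metric.infDist (β v1) (α '' Icc 0 La) ≤ M + 22 * C := by
  by_contra hcon
  push Not at hcon
  have hcF : ContinuousOn (fun t => Metric.infDist (β t) (α '' Icc 0 La)) (Icc v1 v0) :=
    (Metric.continuous_infDist_pt _).comp_continuousOn
      ((seg_contOn hβ).mono (Icc_subset_Icc hv1.1 hv0.2))
  have lip : ∀ s t, 0 ≤ s → s ≤ t → t ≤ Lb →
      Metric.infDist (β s) (α '' Icc 0 La) ≤ Metric.infDist (β t) (α '' Icc 0 La) + (t - s) := by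
    intro s t h1 h2 h3
    rw [← seg_dist hβ h1 h2 h3]
    exact Metric.infDist_le_infDist_add_dist
  have hcl : IsCompact (Icc v1 v0 ∩ (fun t => Metric.infDist (β t) (α '' Icc 0 La)) ⁻¹' Iic M) :=
    isCompact_Icc.of_isClosed_subset
      (hcF.preimage_isClosed_of_isClosed isClosed_Icc isClosed_Iic) inter_subset_left
  obtain ⟨v, ⟨hvm, hvM⟩, hleast⟩ := hcl.exists_isLeast ⟨v0, ⟨hv1.2, le_rfl⟩, hf⟩
  have hvM' : Metric.infDist (β v) (α '' Icc 0 La) ≤ M := hvM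
  have hvL : v ≤ Lb := hvm.2.trans hv0.2
  have hafter : ∀ t, v1 ≤ t → t < v → M < Metric.infDist (β t) (α '' Icc 0 La) := by
    intro t h1 h2
    by_contra h3
    push Not at h3
    have := hleast ⟨⟨h1, h2.le.trans hvm.2⟩, h3⟩
    linarith
  have hl1 := lip v1 v hv1.1 hvm.1 hvL
  have hge : M ≤ Metric.infDist (β v) (α '' Icc 0 La) := by
    by_contra hlt
    push Not at hlt
    have hlt2 : max v1 (v - (M - Metric.infDist (β v) (α '' Icc 0 La))) < v :=
      max_lt (by linarith) (by linarith)
    have k1 := hafter _ (le_max_left _ _) hlt2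
    have k2 := lip _ v (hv1.1.trans (le_max_left _ _)) hlt2.le hvL
    have k3 := le_max_right v1 (v - (M - Metric.infDist (β v) (α '' Icc 0 La)))
    linarith
  refine no_descent hC hX H hα hβ hα0 hβ0 ⟨hv1.1.trans hvm.1, hvL⟩ (hM.trans hge) ?_
  intro t ht hwt
  rcases eq_or_lt_of_le ht.2 with h | h
  · rw [h]
  · exact hvM'.trans (hafter t (by linarith) h).le

lemma qg_corner {ζ η : ℝ → X} {L v : ℝ} {e p : X} (hη : IsGeodesicSeg η L) (hv : v ∈ Icc 0 L)
    (hp : η v = p) (hnear : ∀ t ∈ Icc 0 L, dist e p ≤ dist e (η t))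
    (hζ : IsGeodesicFromTo ζ e p) :
    IsQuasiGeodesicOn 3 0 (Icc 0 (dist e p + (L - v)))
      (fun t => if t ≤ dist e p then ζ t else η (t - dist e p + v)) := by
  obtain ⟨hseg, h0, h1⟩ := hζ
  have q1 : IsQuasiGeodesicOn 3 0 (Icc 0 (dist e p)) ζ := by
    simpa using qg_seg (b := 0) (c := dist e p) (u := 0) hseg le_rfl (by linarith)
  have q2 : IsQuasiGeodesicOn 3 0 (Icc (dist e p) (dist e p + (L - v)))
      (fun t => η (t - dist e p + v)) :=
    qg_seg (b := dist e p) (c := dist e p + (L - v)) (u := v) hη hv.1 (by linarith)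
  refine qg_concat dist_nonneg (by linarith [hv.2]) q1 q2 (by simp [h1, hp]) ?_
  intro s hs t ht
  have m : t - dist e p + v ∈ Icc 0 L := ⟨by linarith [ht.1, hv.1], by linarith [ht.2]⟩
  have k1 := hnear _ m
  have k2 := seg_dist hseg le_rfl hs.1 hs.2
  have k3 := seg_dist hseg hs.1 hs.2 le_rfl
  have k4 := seg_dist hη (s := v) (t := t - dist e p + v) hv.1 (by linarith [ht.1]) m.2
  rw [h0] at k2
  rw [h1] at k3
  rw [hp] at k4
  have k5 := dist_triangle e (ζ s) (η (t - dist e p + v))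
  have k6 := dist_triangle_left p (η (t - dist e p + v)) (ζ s)
  linarith

/-- A nearest point `p = η v` to `e` on a segment `η` is close to every geodesic
from `e` to the end of `η`. -/
lemma corner_near {e : X} {C : ℝ} (hC : 0 < C) (hX : GeodesicSpace X) (H : StabAt e C)
    {η α : ℝ → X} {L v : ℝ} {x : X} (hη : IsGeodesicSeg η L) (hv : v ∈ Icc 0 L)
    (hx : η L = x)
    (hnear : ∀ t ∈ Icc 0 L, dist e (η v) ≤ dist e (η t)) (hα : IsGeodesicFromTo α e x) :
    Metric.infDist (η v) (α '' Icc 0 (dist e x)) ≤ 34 * C := by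
  obtain ⟨ζ, hζ⟩ := hX e (η v)
  have hq := qg_corner hη hv rfl hnear hζ
  have hd : 0 ≤ dist e (η v) := dist_nonneg
  have hvL := hv.2
  obtain ⟨γ, ⟨hγ, hγ0, hγ1⟩, h⟩ := H x 0 _ (by linarith) _ hq (by simp [hd, hζ.2.1]) (by
    split_ifs with hc
    · have : v = L := by linarith
      rw [this, sub_self, add_zero, ← hx, ← this]; exact hζ.2.2
    · rw [← hx]; congr 1; ring)
  obtain ⟨t, ht, hdt⟩ := h (dist e (η v)) ⟨hd, by linarith⟩
  simp only [le_refl, if_true, hζ.2.2] at hdt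
  obtain ⟨hαs, hα0, hα1⟩ := hα
  have hend : Metric.infDist (γ (dist e x)) (α '' Icc 0 (dist e x)) ≤ 11 * C := by
    have := infDist_le' (γ := α) (a := 0) (b := dist e x) (u := dist e x)
      ⟨dist_nonneg, le_rfl⟩ (γ (dist e x))
    rw [hα1] at this
    rw [show dist (γ (dist e x)) x = 0 by rw [hγ1, dist_self]] at this
    linarith
  have k := dist_control hC hX H hαs hγ hα0 hγ0 (v0 := dist e x) ⟨dist_nonneg, le_rfl⟩
    le_rfl hend ht
  have k2 : Metric.infDist (η v) (α '' Icc 0 (dist e x)) ≤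
    Metric.infDist (γ t) (α '' Icc 0 (dist e x)) + dist (η v) (γ t) :=
    Metric.infDist_le_infDist_add_dist
  linarith

lemma seg_reverse {η : ℝ → X} {L : ℝ} (h : IsGeodesicSeg η L) :
    IsGeodesicSeg (fun t => η (L - t)) L := by
  refine ⟨h.1, fun s hs t ht => ?_⟩
  have := h.2 (L - s) ⟨by linarith [hs.2], by linarith [hs.1]⟩ (L - t)
    ⟨by linarith [ht.2], by linarith [ht.1]⟩
  rw [this, abs_sub_comm]
  congr 1; ring

lemma gprod_le_left (w x y : X) : gprod w x y ≤ dist w x := by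
  have := dist_triangle w x y
  unfold gprod; linarith

lemma gprod_le_right (w x y : X) : gprod w x y ≤ dist w y := by
  have := dist_triangle_right w x y
  unfold gprod; linarith

lemma gprod_nonneg' (w x y : X) : 0 ≤ gprod w x y := by
  have := dist_triangle_left x y w
  unfold gprod; linarith

lemma fellow_travel {e : X} {C : ℝ} (hC : 0 < C) (hX : GeodesicSpace X) (H : StabAt e C)
    {α β : ℝ → X} {x y : X} (hα : IsGeodesicFromTo α e x) (hβ : IsGeodesicFromTo β e y)
    {m : ℝ} (hm : 0 ≤ m) (hm2 : m ≤ gprod e x y) : dist (α m) (β m) ≤ 248 * C := by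
  obtain ⟨η, hη, hη0, hη1⟩ := hX x y
  have hmx := hm2.trans (gprod_le_left e x y)
  have hmy := hm2.trans (gprod_le_right e x y)
  set L := dist x y with hL
  obtain ⟨v, hv, hDv⟩ := infDist_attained hη.1 (seg_contOn hη) e
  have hnear : ∀ t ∈ Icc 0 L, dist e (η v) ≤ dist e (η t) := by
    intro t ht; rw [← hDv]; exact infDist_le' ht _
  have n2 := corner_near hC hX H hη hv hη1 hnear hβ
  have n1 := corner_near hC hX H (seg_reverse hη) (v := L - v) (x := x)
    ⟨by linarith [hv.2], by linarith [hv.1]⟩ (by simp [hη0]) (by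
      intro t ht
      simp only [sub_sub_cancel]
      exact hnear _ ⟨by linarith [ht.2], by linarith [ht.1]⟩) hα
  simp only [sub_sub_cancel] at n1
  have hmp : m ≤ dist e (η v) := by
    have k1 := seg_dist hη le_rfl hv.1 hv.2
    have k2 := seg_dist hη hv.1 hv.2 le_rfl
    rw [hη0] at k1
    rw [hη1] at k2
    have k3 := dist_triangle_right e x (η v)
    have k4 := dist_triangle e (η v) y
    unfold gprod at hm2
    linarith
  obtain ⟨hαs, hα0, hα1⟩ := hα
  obtain ⟨hβs, hβ0, hβ1⟩ := hβ
  obtain ⟨v0, hv0, hdv0⟩ := infDist_attained hβs.1 (seg_contOn hβs) (η v)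
  rw [hdv0] at n2
  have hf : Metric.infDist (β v0) (α '' Icc 0 (dist e x)) ≤ 68 * C := by
    have : Metric.infDist (β v0) (α '' Icc 0 (dist e x)) ≤
      Metric.infDist (η v) (α '' Icc 0 (dist e x)) + dist (β v0) (η v) :=
      Metric.infDist_le_infDist_add_dist
    rw [dist_comm (β v0)] at this
    linarith
  have hv0e : dist e (β v0) = v0 := by
    have := seg_dist hβs le_rfl hv0.1 hv0.2
    rw [hβ0] at this; linarith
  have hv0g : m - 34 * C ≤ v0 := by
    have := dist_triangle_right e (η v) (β v0)
    linarith
  have hfm : Metric.infDist (β m) (α '' Icc 0 (dist e x)) ≤ 124 * C := by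
    have k := dist_control hC hX H hαs hβs hα0 hβ0 hv0 (by linarith) hf (v1 := min m v0)
      ⟨le_min hm hv0.1, min_le_right _ _⟩
    have k2 : Metric.infDist (β m) (α '' Icc 0 (dist e x)) ≤
      Metric.infDist (β (min m v0)) (α '' Icc 0 (dist e x)) + dist (β m) (β (min m v0)) :=
      Metric.infDist_le_infDist_add_dist
    rw [dist_comm (β m), seg_dist hβs (le_min hm hv0.1) (min_le_left _ _) hmy] at k2
    have k3 : m - 34 * C ≤ min m v0 := le_min (by linarith) hv0g
    linarith
  obtain ⟨u, hu, hdu⟩ := infDist_attained hαs.1 (seg_contOn hαs) (β m)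
  rw [hdu] at hfm
  have heu : dist e (α u) = u := by
    have := seg_dist hαs le_rfl hu.1 hu.2
    rw [hα0] at this; linarith
  have hem : dist e (β m) = m := by
    have := seg_dist hβs le_rfl hm hmy
    rw [hβ0] at this; linarith
  have k1 := dist_triangle e (α u) (β m)
  have k2 := dist_triangle e (β m) (α u)
  rw [dist_comm (α u)] at k1
  have k3 : dist (α m) (α u) ≤ 124 * C := by
    rw [hαs.2 m ⟨hm, hmx⟩ u hu, abs_le]
    constructor <;> linarith
  have k4 := dist_triangle_right (α m) (β m) (α u)
  linarith

lemma four_point_at {e : X} {C : ℝ} (hC : 0 < C) (hX : GeodesicSpace X) (H : StabAt e C)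
    (x y z : X) : min (gprod e x z) (gprod e z y) - 248 * C ≤ gprod e x y := by
  obtain ⟨α, hα⟩ := hX e x
  obtain ⟨β, hβ⟩ := hX e y
  obtain ⟨ζ, hζ⟩ := hX e z
  set m := min (gprod e x z) (gprod e z y) with hm
  have h0 : 0 ≤ m := le_min (gprod_nonneg' _ _ _) (gprod_nonneg' _ _ _)
  have h1 : m ≤ gprod e x z := min_le_left _ _
  have h2 : m ≤ gprod e z y := min_le_right _ _
  have f1 := fellow_travel hC hX H hα hζ h0 h1
  have f2 := fellow_travel hC hX H hζ hβ h0 h2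
  have hx := h1.trans (gprod_le_left e x z)
  have hy := h2.trans (gprod_le_right e z y)
  have k1 := seg_dist hα.1 h0 hx le_rfl
  have k2 := seg_dist hβ.1 h0 hy le_rfl
  rw [hα.2.2, dist_comm] at k1
  rw [hβ.2.2] at k2
  have k3 := dist_triangle4 x (α m) (β m) y
  have k4 := dist_triangle (α m) (ζ m) (β m)
  unfold gprod
  linarith

lemma change_base {e : X} {δ : ℝ}
    (H : ∀ x y z : X, min (gprod e x z) (gprod e z y) - δ ≤ gprod e x y) (w x y z : X) :
    min (gprod w x z) (gprod w z y) - 2 * δ ≤ gprod w x y := by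
  have h1 := H x y z
  have h2 := H x y w
  have h3 := H z w x
  have h4 := H z w y
  have e1 : gprod w x y = dist e w + gprod e x y - gprod e x w - gprod e w y := by
    unfold gprod; rw [dist_comm w x]; ring
  have e2 : gprod w x z = dist e w + gprod e x z - gprod e x w - gprod e z w := by
    unfold gprod; rw [dist_comm w x, dist_comm w z]; ring
  have e3 : gprod w z y = dist e w + gprod e z y - gprod e z w - gprod e w y := by
    unfold gprod; rw [dist_comm w z]; ring
  have s1 : gprod e z x = gprod e x z := by unfold gprod; rw [dist_comm z x]; ring
  have s2 : gprod e y w = gprod e w y := by unfold gprod; rw [dist_comm y w]; ring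
  rw [e1, e2, e3]
  rw [s1] at h3
  rw [s2] at h4
  generalize gprod e x y = xy at *
  generalize gprod e x z = xz at *
  generalize gprod e z y = zy at *
  generalize gprod e x w = xw at *
  generalize gprod e w y = wy at *
  generalize gprod e z w = zw at *
  clear e1 e2 e3 s1 s2 H
  rw [sub_le_iff_le_add, min_le_iff] at *
  by_contra hcon
  push Not at hcon
  obtain ⟨c1, c2⟩ := hcon
  rcases h1 with h1 | h1 <;> rcases h2 with h2 | h2 <;> rcases h3 with h3 | h3 <;>
    rcases h4 with h4 | h4 <;> linarith

end Proofs

/-- a geodesic space is δ-hyperbolic for some δ ≥ 0 iff there are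
a basepoint `e` and a constant `C ≥ 0` such that every `(3,0)`-quasi-geodesic
from `e` to any point `x` is contained in the closed `C`-neighbourhood of some
geodesic from `e` to `x`. -/
theorem statement11 {X : Type*} [MetricSpace X] [Nonempty X]
    (hX : GeodesicSpace X) :
    (∃ δ : ℝ, 0 ≤ δ ∧
        ∀ w x y z : X, gprod w x y ≥ min (gprod w x z) (gprod w z y) - δ) ↔
    (∃ e : X, ∃ C : ℝ, 0 ≤ C ∧ ∀ x : X, ∀ a b : ℝ, a ≤ b → ∀ σ : ℝ → X,
        IsQuasiGeodesicOn 3 0 (Icc a b) σ → σ a = e → σ b = x →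
        ∃ γ : ℝ → X, IsGeodesicFromTo γ e x ∧
          ∀ s ∈ Icc a b, ∃ t ∈ Icc (0:ℝ) (dist e x), dist (σ s) (γ t) ≤ C) := by
  constructor
  · rintro ⟨δ, hδ, H⟩
    obtain ⟨C, hC, h⟩ := qg_near_geod hδ H
    refine ⟨Classical.arbitrary X, C, hC, ?_⟩
    intro x a b hab σ hq ha hb
    obtain ⟨γ, hγ⟩ := hX (Classical.arbitrary X) x
    exact ⟨γ, hγ, h _ x a b σ γ hab hq ha hb hγ⟩
  · rintro ⟨e, C, hC, h⟩
    have H : StabAt e (C + 1) := by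
      intro x a b hab σ hq ha hb
      obtain ⟨γ, hγ, hn⟩ := h x a b hab σ hq ha hb
      refine ⟨γ, hγ, fun s hs => ?_⟩
      obtain ⟨t, ht, hd⟩ := hn s hs
      exact ⟨t, ht, by linarith⟩
    refine ⟨2 * (248 * (C + 1)), by positivity, ?_⟩
    intro w x y z
    exact change_base (four_point_at (by linarith) hX H) w x y z
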